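/- Each of the vectors B_Q v₁, B_Q v₂, B_Q w₁, B_Q w₂ lies in ℤ⁶ (so v₁, v₂, w₁, w₂ belong to the dual lattice Q* = {x ∈ ℚ⁶ : B_Q x ∈ ℤ⁶}), the classes of v₁, v₂, w₁, w₂ generate the quotient group Q*/ℤ⁶, and in this quotient v₁ and v₂ have order 2 while w₁ and w₂ have order 4; in particular Q*/ℤ⁶ ≅ ℤ₂² ⊕ ℤ₄². -/

import Mathlib

open Matrix

/-- The Gram matrix `B_Q` (over `ℚ`) of the rank-6 lattice `Q` such that the Néron–Severi
lattice of a triple-double K3 surface with minimal Picard number is isometric to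
`U ⊕ E₈ ⊕ Q`. -/
def B_Q : Matrix (Fin 6) (Fin 6) ℚ :=
  !![-2,  0,  1,   0,  2,  -1;
      0, -6, -1,  -4,  4,  -5;
      1, -1, -8,   6,  2,   0;
      0, -4,  6, -16,  4,  -2;
      2,  4,  2,   4, -8,   6;
     -1, -5,  0,  -2,  6, -12]

def v₁ : Fin 6 → ℚ := ![1/2, -1/2, 0, 0, 1/2, 0]
def v₂ : Fin 6 → ℚ := ![-1/2, 1/2, 0, 0, 0, 0]
def w₁ : Fin 6 → ℚ := ![1/2, 0, 0, -1/4, 0, 0]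
def w₂ : Fin 6 → ℚ := ![0, 0, 1/4, -1/4, -1/4, -1/4]

/-- The standard lattice `ℤ⁶ ⊂ ℚ⁶`. -/
def intLat : Submodule ℤ (Fin 6 → ℚ) :=
  Submodule.span ℤ (Set.range fun i : Fin 6 => (Pi.single i 1 : Fin 6 → ℚ))

/-- The dual lattice `Q* = {x ∈ ℚ⁶ : B_Q x ∈ ℤ⁶}`. -/
def Qstar : Submodule ℤ (Fin 6 → ℚ) :=
  Submodule.comap (B_Q.mulVecLin.restrictScalars ℤ) intLat

lemma mem_intLat_iff (x : Fin 6 → ℚ) : x ∈ intLat ↔ ∀ i, ∃ n : ℤ, x i = n := by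
  have h : ⇑(Pi.basisFun ℚ (Fin 6)) = fun i => (Pi.single i 1 : Fin 6 → ℚ) :=
    funext fun i => Pi.basisFun_apply ℚ (Fin 6) i
  rw [intLat, ← h, Module.Basis.mem_span_iff_repr_mem]
  simp [eq_comm]

lemma mem_Qstar_iff (x : Fin 6 → ℚ) : x ∈ Qstar ↔ ∀ i, ∃ n : ℤ, (B_Q *ᵥ x) i = n :=
  mem_intLat_iff (B_Q *ᵥ x)

/-- The four generators of the discriminant group, as vectors of `ℚ⁶`. -/
def discGen : Fin 4 → Fin 6 → ℚ := ![v₁, v₂, w₁, w₂]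

/-- The homomorphism `ℤ⁴ → ℚ⁶/ℤ⁶` sending the standard basis to the classes of
`v₁, v₂, w₁, w₂`. -/
def discMap : (Fin 4 → ℤ) →ₗ[ℤ] ((Fin 6 → ℚ) ⧸ intLat) :=
  intLat.mkQ ∘ₗ Fintype.linearCombination ℤ discGen

lemma linearCombination_discGen (c : Fin 4 → ℤ) :
    Fintype.linearCombination ℤ discGen c =
      ![(c 0 - c 1 + c 2 : ℚ) / 2, (c 1 - c 0 : ℚ) / 2, (c 3 : ℚ) / 4, -(c 2 + c 3 : ℚ) / 4,
        (c 0 : ℚ) / 2 - c 3 / 4, -(c 3 : ℚ) / 4] := by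
  ext i
  fin_cases i <;>
    simp [Fintype.linearCombination_apply, Fin.sum_univ_four, discGen, v₁, v₂, w₁, w₂] <;> ring

lemma discGen_mem_Qstar (j : Fin 4) : discGen j ∈ Qstar := by
  have h (j : Fin 4) : B_Q *ᵥ discGen j =
      fun i => ((![![0, 5, 2, 4, -5, 5], ![1, -3, -1, -2, 1, -2],
        ![-1, 1, -1, 4, 0, 0], ![0, 1, -4, 5, 0, 2]] j i : ℤ) : ℚ) := by
    ext i
    fin_cases j <;> fin_cases i <;>
      simp [discGen, B_Q, v₁, v₂, w₁, w₂, Matrix.mulVec, dotProduct, Fin.sum_univ_six] <;> norm_num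
  rw [mem_Qstar_iff, h]
  exact fun i => ⟨_, rfl⟩

lemma exists_sub_mem_intLat {x : Fin 6 → ℚ} (hx : x ∈ Qstar) :
    ∃ c : Fin 4 → ℤ, x - Fintype.linearCombination ℤ discGen c ∈ intLat := by
  rw [mem_Qstar_iff] at hx
  choose y hy using hx
  have h0 := hy 0
  have h1 := hy 1
  have h2 := hy 2
  have h3 := hy 3
  have h4 := hy 4
  have h5 := hy 5
  simp [B_Q, Matrix.mulVec, dotProduct, Fin.sum_univ_six] at h0 h1 h2 h3 h4 h5
  refine ⟨![-317 * y 0 + 39 * y 1 - 216 * y 2 - 143 * y 3 - 256 * y 4 - 94 * y 5,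
    -291 * y 0 + 35 * y 1 - 198 * y 2 - 131 * y 3 - 235 * y 4 - 86 * y 5,
    482 * y 0 - 60 * y 1 + 329 * y 2 + 218 * y 3 + 389 * y 4 + 143 * y 5,
    -290 * y 0 + 36 * y 1 - 198 * y 2 - 131 * y 3 - 234 * y 4 - 86 * y 5], ?_⟩
  rw [mem_intLat_iff, linearCombination_discGen]
  intro i
  refine ⟨![-335 * y 0 + 41 * y 1 - 228 * y 2 - 151 * y 3 - 270 * y 4 - 99 * y 5, 0, 0, 0, 0,
    -104 * y 0 + 13 * y 1 - 71 * y 2 - 47 * y 3 - 84 * y 4 - 31 * y 5] i, ?_⟩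
  fin_cases i <;> simp <;> linarith

lemma discMap_eq_zero_iff (c : Fin 4 → ℤ) :
    discMap c = 0 ↔ 2 ∣ c 0 ∧ 2 ∣ c 1 ∧ 4 ∣ c 2 ∧ 4 ∣ c 3 := by
  rw [discMap, LinearMap.comp_apply, Submodule.mkQ_apply, Submodule.Quotient.mk_eq_zero,
    mem_intLat_iff, linearCombination_discGen]
  constructor
  · intro h
    obtain ⟨n1, h1⟩ := h 1
    obtain ⟨n2, h2⟩ := h 2
    obtain ⟨n3, h3⟩ := h 3
    obtain ⟨n4, h4⟩ := h 4
    simp at h1 h2 h3 h4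
    have e2 : c 3 = 4 * n2 := by
      have : (c 3 : ℚ) = 4 * n2 := by linarith
      exact_mod_cast this
    have e3 : c 2 = -4 * n3 - 4 * n2 := by
      have : (c 2 : ℚ) = -4 * n3 - 4 * n2 := by linarith
      exact_mod_cast this
    have e4 : c 0 = 2 * n4 + 2 * n2 := by
      have : (c 0 : ℚ) = 2 * n4 + 2 * n2 := by linarith
      exact_mod_cast this
    have e1 : c 1 = 2 * n1 + c 0 := by
      have : (c 1 : ℚ) = 2 * n1 + c 0 := by linarith
      exact_mod_cast this
    omega
  · rintro ⟨⟨a, ha⟩, ⟨b, hb⟩, ⟨k, hk⟩, ⟨d, hd⟩⟩ i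
    refine ⟨![a - b + 2 * k, b - a, d, -k - d, a - d, -d] i, ?_⟩
    fin_cases i <;> simp [ha, hb, hk, hd] <;> ring

lemma range_discMap : LinearMap.range discMap = Submodule.map intLat.mkQ Qstar := by
  apply le_antisymm
  · rw [discMap, LinearMap.range_comp, Fintype.range_linearCombination]
    apply Submodule.map_mono
    rw [Submodule.span_le]
    rintro _ ⟨j, rfl⟩
    exact discGen_mem_Qstar j
  · rintro _ ⟨x, hx, rfl⟩
    obtain ⟨c, hc⟩ := exists_sub_mem_intLat hx
    exact ⟨c, ((Submodule.Quotient.eq intLat).2 hc).symm⟩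

lemma span_mkQ_discGen :
    Submodule.span ℤ {intLat.mkQ v₁, intLat.mkQ v₂, intLat.mkQ w₁, intLat.mkQ w₂}
      = LinearMap.range discMap := by
  rw [discMap, LinearMap.range_comp, Fintype.range_linearCombination, Submodule.map_span,
    ← Set.range_comp]
  congr 1
  ext y
  simp [discGen, Fin.exists_fin_succ, eq_comm]

lemma nsmul_mkQ_discGen (j : Fin 4) (n : ℕ) :
    n • intLat.mkQ (discGen j) = discMap (Pi.single j (n : ℤ)) := by
  rw [discMap, LinearMap.comp_apply, Fintype.linearCombination_apply_single, map_smul,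
    natCast_zsmul]

lemma addOrderOf_mkQ_discGen (j : Fin 4) :
    addOrderOf (intLat.mkQ (discGen j)) = ![2, 2, 4, 4] j := by
  refine Nat.dvd_right_iff_eq.1 fun n => ?_
  rw [addOrderOf_dvd_iff_nsmul_eq_zero, nsmul_mkQ_discGen, discMap_eq_zero_iff]
  fin_cases j <;> simp <;> omega

/-- Reduction of the coordinates of `ℤ⁴` modulo `2, 2, 4, 4`. -/
def redMap : (Fin 4 → ℤ) →+ ZMod 2 × ZMod 2 × ZMod 4 × ZMod 4 where
  toFun c := (c 0, c 1, c 2, c 3)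
  map_zero' := by simp
  map_add' c d := by simp

lemma redMap_surjective : Function.Surjective redMap := by
  rintro ⟨a, b, c, d⟩
  obtain ⟨a, rfl⟩ := ZMod.intCast_surjective a
  obtain ⟨b, rfl⟩ := ZMod.intCast_surjective b
  obtain ⟨c, rfl⟩ := ZMod.intCast_surjective c
  obtain ⟨d, rfl⟩ := ZMod.intCast_surjective d
  exact ⟨![a, b, c, d], rfl⟩

lemma ker_discMap : discMap.toAddMonoidHom.ker = redMap.ker := by
  ext c
  rw [AddMonoidHom.mem_ker, AddMonoidHom.mem_ker, LinearMap.toAddMonoidHom_coe,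
    discMap_eq_zero_iff]
  simp [redMap, Prod.ext_iff, (ZMod.intCast_zmod_eq_zero_iff_dvd · 2),
    (ZMod.intCast_zmod_eq_zero_iff_dvd · 4)]

/-- The discriminant group of `Q` is `ℤ₂² ⊕ ℤ₄²`. -/
noncomputable def discEquiv : LinearMap.range discMap ≃+ ZMod 2 × ZMod 2 × ZMod 4 × ZMod 4 :=
  (QuotientAddGroup.quotientKerEquivRange discMap.toAddMonoidHom).symm.trans <|
    (QuotientAddGroup.quotientAddEquivOfEq ker_discMap).trans <|
      QuotientAddGroup.quotientKerEquivOfSurjective redMap redMap_surjective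

/-- `v₁, v₂, w₁, w₂` lie in the dual lattice `Q*` (i.e. `B_Q vᵢ, B_Q wᵢ ∈ ℤ⁶`), their
classes generate the quotient `Q*/ℤ⁶`, in which `v₁, v₂` have order `2` and `w₁, w₂` have
order `4`; in particular `Q*/ℤ⁶ ≅ ℤ₂² ⊕ ℤ₄²`. -/
theorem stmt_3 :
    (∀ i, ∃ n : ℤ, (B_Q *ᵥ v₁) i = n) ∧
    (∀ i, ∃ n : ℤ, (B_Q *ᵥ v₂) i = n) ∧
    (∀ i, ∃ n : ℤ, (B_Q *ᵥ w₁) i = n) ∧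
    (∀ i, ∃ n : ℤ, (B_Q *ᵥ w₂) i = n) ∧
    Submodule.span ℤ {intLat.mkQ v₁, intLat.mkQ v₂, intLat.mkQ w₁, intLat.mkQ w₂}
      = Submodule.map intLat.mkQ Qstar ∧
    addOrderOf (intLat.mkQ v₁) = 2 ∧
    addOrderOf (intLat.mkQ v₂) = 2 ∧
    addOrderOf (intLat.mkQ w₁) = 4 ∧
    addOrderOf (intLat.mkQ w₂) = 4 ∧
    Nonempty ((Submodule.map intLat.mkQ Qstar) ≃+
      (ZMod 2 × ZMod 2 × ZMod 4 × ZMod 4)) := by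
  refine ⟨(mem_Qstar_iff _).1 (discGen_mem_Qstar 0), (mem_Qstar_iff _).1 (discGen_mem_Qstar 1),
    (mem_Qstar_iff _).1 (discGen_mem_Qstar 2), (mem_Qstar_iff _).1 (discGen_mem_Qstar 3),
    span_mkQ_discGen.trans range_discMap, addOrderOf_mkQ_discGen 0, addOrderOf_mkQ_discGen 1,
    addOrderOf_mkQ_discGen 2, addOrderOf_mkQ_discGen 3, ?_⟩
  rw [← range_discMap]
  exact ⟨discEquiv⟩
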